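/- arXiv:1310.2273 — 3 statements merged into one kernel-verified Lean document; each statement's English description precedes it below -/
import Mathlib

section
/- There exist universal constants c₁ > 0 and c₂ > 0 such that the following holds. For every near-separable instance M̃ = WH + N as in the assumption, if ε ≤ c₁ · σ_min(W) / (√r · κ(W)²), then the index set K produced by SPA applied to M̃ with parameter r (for any tie-breaking choices in the argmax steps) satisfies max_{1≤j≤r} min_{k∈K} ‖W(:,j) − M̃(:,k)‖₂ ≤ c₂ · ε · κ(W)². -/
open Matrix BigOperators

/-- Euclidean norm of a vector in `ℝ^m`. -/
noncomputable def colNorm {m : ℕ} (v : Fin m → ℝ) : ℝ := Real.sqrt (∑ i, (v i) ^ 2)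

/-- Largest singular value of a matrix. -/
noncomputable def sigmaMax {m n : ℕ} (X : Matrix (Fin m) (Fin n) ℝ) : ℝ :=
  sSup {c : ℝ | ∃ v : Fin n → ℝ, colNorm v = 1 ∧ c = colNorm (X.mulVec v)}

/-- Smallest singular value of a matrix. -/
noncomputable def sigmaMin {m n : ℕ} (X : Matrix (Fin m) (Fin n) ℝ) : ℝ :=
  sInf {c : ℝ | ∃ v : Fin n → ℝ, colNorm v = 1 ∧ c = colNorm (X.mulVec v)}

/-- Condition number `κ(X) = σ_max(X) / σ_min(X)`. -/
noncomputable def kappa {m n : ℕ} (X : Matrix (Fin m) (Fin n) ℝ) : ℝ :=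
  sigmaMax X / sigmaMin X

/-- Projection of the columns of `X` onto the orthogonal complement of `u`:
`X ← (I − uuᵀ/‖u‖²) X`. -/
noncomputable def projOut {m n : ℕ} (u : Fin m → ℝ) (X : Matrix (Fin m) (Fin n) ℝ) :
    Matrix (Fin m) (Fin n) ℝ :=
  fun i j => X i j - ((∑ l, u l * X l j) / (∑ l, u l * u l)) * u i

/-- `IsSPA X r K` holds iff `K` is a possible output of the successive projection algorithm
applied to `X` with `r` steps (for some tie-breaking choices in the argmax steps). -/
inductive IsSPA {m n : ℕ} : Matrix (Fin m) (Fin n) ℝ → ℕ → Finset (Fin n) → Prop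
  | nil (X : Matrix (Fin m) (Fin n) ℝ) : IsSPA X 0 ∅
  | step (X : Matrix (Fin m) (Fin n) ℝ) (r : ℕ) (k : Fin n) (K : Finset (Fin n)) :
      (∀ j : Fin n, colNorm (fun i => X i j) ≤ colNorm (fun i => X i k)) →
      IsSPA (projOut (fun i => X i k) X) r K →
      IsSPA X (r + 1) (insert k K)

/-- Near-separable assumption: `Mt = W * H + N` where `W` has full column rank,
`H` is nonnegative with column sums at most one and contains each standard basis vector
among its columns, and each column of `N` has Euclidean norm at most `ε`. -/
def NearSeparable (m n r : ℕ) (W : Matrix (Fin m) (Fin r) ℝ) (H : Matrix (Fin r) (Fin n) ℝ)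
    (N Mt : Matrix (Fin m) (Fin n) ℝ) (ε : ℝ) : Prop :=
  Mt = W * H + N ∧ W.rank = r ∧ (∀ i j, 0 ≤ H i j) ∧ (∀ j, ∑ i, H i j ≤ 1) ∧
    (∀ j : Fin r, ∃ c : Fin n, ∀ i, H i c = if i = j then 1 else 0) ∧
    0 ≤ ε ∧ ∀ j, colNorm (fun i => N i j) ≤ ε

section Geometry

variable {E : Type*} [NormedAddCommGroup E] [InnerProductSpace ℝ E]
variable {ι : Type*} [Fintype ι]

/-- A subconvex combination whose norm is nearly maximal puts nearly all its weight on one of the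
long, well-separated vectors. -/
theorem exists_weight_near_one [DecidableEq ι] (J : Finset ι) (hJ : J.Nonempty)
    (a : ι → E) (h : ι → ℝ) (h0 : ∀ i, 0 ≤ h i) (h1 : ∑ i, h i ≤ 1) {M σ η : ℝ} (hσ : 0 < σ) (hσM : σ ≤ M)
    (hη : η ≤ σ / 2) (hM : ∀ i ∈ J, ‖a i‖ ≤ M) (hsmall : ∀ i ∉ J, ‖a i‖ ≤ η)
    (hsep : ∀ i ∈ J, ∀ j ∈ J, i ≠ j → 2 * σ ^ 2 ≤ ‖a i - a j‖ ^ 2) :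
    ∃ i ∈ J, σ ^ 2 / 4 * (1 - h i) ≤ M ^ 2 - ‖∑ i, h i • a i‖ ^ 2 := by
  obtain ⟨i₀, hi₀, hmax⟩ := J.exists_max_image h hJ
  refine ⟨i₀, hi₀, ?_⟩
  set T := ∑ i, h i with hT
  have hM0 : 0 < M := hσ.trans_le hσM
  have hall : ∀ i, ‖a i‖ ≤ M := fun i => by
    by_cases hi : i ∈ J
    · exact hM i hi
    · exact (hsmall i hi).trans (by linarith)
  have hcross : ∀ i j, ‖a i‖ ≤ η → inner ℝ (a i) (a j) ≤ M ^ 2 - σ ^ 2 / 2 := fun i j hi => by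
    have h2 : ‖a i‖ * ‖a j‖ ≤ σ / 2 * M :=
      mul_le_mul (hi.trans hη) (hall j) (norm_nonneg _) (by positivity)
    nlinarith [real_inner_le_norm (a i) (a j)]
  have hG : ∀ i j, inner ℝ (a i) (a j) ≤
      M ^ 2 - σ ^ 2 / 2 + if i = j then (if i ∈ J then σ ^ 2 / 2 else 0) else 0 := by
    intro i j
    by_cases hi : i ∈ J
    · by_cases hij : i = j
      · subst hij
        have := hM i hi
        have h2 := pow_le_pow_left₀ (norm_nonneg (a i)) this 2
        simp only [hi, if_true, real_inner_self_eq_norm_sq]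
        linarith
      · by_cases hj : j ∈ J
        · have h3 := hsep i hi j hj hij
          rw [norm_sub_sq_real] at h3
          have h4 := pow_le_pow_left₀ (norm_nonneg (a i)) (hM i hi) 2
          have h5 := pow_le_pow_left₀ (norm_nonneg (a j)) (hM j hj) 2
          simp only [hij, if_false]
          nlinarith
        · simp only [hij, if_false, add_zero]
          rw [real_inner_comm]
          exact hcross j i (hsmall j hj)
    · simp only [hi, if_false, ite_self, add_zero]
      exact hcross i j (hsmall i hi)
  have hexp : ‖∑ i, h i • a i‖ ^ 2 = ∑ i, ∑ j, h i * h j * inner ℝ (a i) (a j) := by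
    rw [← real_inner_self_eq_norm_sq, sum_inner]
    refine Finset.sum_congr rfl fun i _ => ?_
    rw [inner_sum]
    refine Finset.sum_congr rfl fun j _ => ?_
    rw [real_inner_smul_left, real_inner_smul_right]
    ring
  have hbound : ‖∑ i, h i • a i‖ ^ 2 ≤
      T ^ 2 * (M ^ 2 - σ ^ 2 / 2) + σ ^ 2 / 2 * ∑ i ∈ J, h i ^ 2 := by
    rw [hexp]
    calc _ ≤ ∑ i, ∑ j, h i * h j * (M ^ 2 - σ ^ 2 / 2 +
            if i = j then (if i ∈ J then σ ^ 2 / 2 else 0) else 0) := by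
          gcongr with i _ j _
          · exact mul_nonneg (h0 i) (h0 j)
          · exact hG i j
      _ = _ := by
          simp only [mul_add, Finset.sum_add_distrib, mul_ite, mul_zero, Finset.sum_ite_eq,
            Finset.mem_univ, if_true, Finset.sum_ite_mem, Finset.univ_inter]
          rw [hT, sq (∑ i, h i), Finset.sum_mul_sum, Finset.sum_mul, Finset.mul_sum]
          congr 1
          · exact Finset.sum_congr rfl fun i _ => (Finset.sum_mul _ _ _).symm
          · exact Finset.sum_congr rfl fun i _ => by ring
  have hJT : ∑ i ∈ J, h i ≤ T :=
    Finset.sum_le_sum_of_subset_of_nonneg (Finset.subset_univ J) fun i _ _ => h0 i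
  have hsq : ∑ i ∈ J, h i ^ 2 ≤ h i₀ * T := by
    calc _ ≤ ∑ i ∈ J, h i₀ * h i := Finset.sum_le_sum fun i hi => by
          rw [sq]; exact mul_le_mul_of_nonneg_right (hmax i hi) (h0 i)
      _ = h i₀ * ∑ i ∈ J, h i := (Finset.mul_sum _ _ _).symm
      _ ≤ _ := mul_le_mul_of_nonneg_left hJT (h0 i₀)
  have hi₀T : h i₀ ≤ T := Finset.single_le_sum (fun i _ => h0 i) (Finset.mem_univ i₀)
  have hT0 : 0 ≤ T := (h0 i₀).trans hi₀T
  have hT1 : 0 ≤ 1 - T ^ 2 := by nlinarith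
  have hweights : (1 - h i₀) / 4 ≤ (1 - T ^ 2) + T * (T - h i₀) / 2 := by
    rcases le_total T (1 / 2) with hle | hge
    · nlinarith [h0 i₀, mul_nonneg hT0 (sub_nonneg.2 hi₀T)]
    · nlinarith [h0 i₀, mul_nonneg (sub_nonneg.2 hge) (sub_nonneg.2 hi₀T)]
  have hσM2 : σ ^ 2 ≤ M ^ 2 := pow_le_pow_left₀ hσ.le hσM 2
  have hA := mul_le_mul_of_nonneg_left hweights (sq_nonneg σ)
  have hB := mul_le_mul_of_nonneg_right hσM2 hT1
  have hC := mul_le_mul_of_nonneg_left hsq (by positivity : 0 ≤ σ ^ 2 / 2)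
  nlinarith

/-- Projection onto the orthogonal complement of `u`. -/
noncomputable def orthComplProj (u : E) : E →ₗ[ℝ] E :=
  LinearMap.id - (inner ℝ u u : ℝ)⁻¹ • (innerₗ E u).smulRight u

theorem orthComplProj_apply (u v : E) :
    orthComplProj u v = v - (inner ℝ u v / inner ℝ u u) • u := by
  simp [orthComplProj, smul_smul, div_eq_inv_mul]

theorem orthComplProj_self (u : E) : orthComplProj u u = 0 := by
  rw [orthComplProj_apply]
  by_cases hu : u = 0
  · simp [hu]
  · rw [div_self (inner_self_ne_zero.2 hu), one_smul, sub_self]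

theorem norm_orthComplProj_le (u v : E) : ‖orthComplProj u v‖ ≤ ‖v‖ := by
  by_cases hu : u = 0
  · simp [hu, orthComplProj_apply]
  have hu' : 0 < ‖u‖ ^ 2 := by positivity
  refine le_of_sq_le_sq ?_ (norm_nonneg _)
  rw [orthComplProj_apply, norm_sub_sq_real, norm_smul, mul_pow, real_inner_smul_right,
    real_inner_self_eq_norm_sq, real_inner_comm u v, Real.norm_eq_abs, sq_abs]
  have : (inner ℝ u v / ‖u‖ ^ 2) ^ 2 * ‖u‖ ^ 2 = inner ℝ u v / ‖u‖ ^ 2 * inner ℝ u v := by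
    field_simp
  rw [this]
  have : 0 ≤ inner ℝ u v / ‖u‖ ^ 2 * inner ℝ u v := by
    rw [div_mul_eq_mul_div]
    exact div_nonneg (mul_self_nonneg _) hu'.le
  linarith

variable {κ : Type*}

/-- The residual map `P` after some steps of the successive projection algorithm on the columns `x`:
`J` is the set of vertices `w i` not extracted yet, and `g i` is the column extracted for `i ∉ J`. -/
structure IsResidualMap (w : ι → E) (x : κ → E) (η : ℝ) (J : Finset ι) (g : ι → κ)
    (P : E →ₗ[ℝ] E) : Prop where
  norm_le : ∀ v, ‖P v‖ ≤ ‖v‖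
  exists_eq : ∀ v, ∃ b : ι → ℝ, (∀ i ∈ J, b i = 0) ∧ P v = v - ∑ i, b i • x (g i)
  map_eq_zero : ∀ i ∉ J, P (x (g i)) = 0
  dist_le : ∀ i ∉ J, ‖w i - x (g i)‖ ≤ η

namespace IsResidualMap

variable {w : ι → E} {x : κ → E} {η : ℝ} {J : Finset ι} {g : ι → κ} {P : E →ₗ[ℝ] E}

theorem norm_map_le (hP : IsResidualMap w x η J g P) {i : ι} (hi : i ∉ J) : ‖P (w i)‖ ≤ η := by
  have : P (w i) = P (w i - x (g i)) := by rw [map_sub, hP.map_eq_zero i hi, sub_zero]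
  rw [this]
  exact (hP.norm_le _).trans (hP.dist_le i hi)

theorem le_norm_map [DecidableEq ι] (hP : IsResidualMap w x η J g P) {σ : ℝ} (hσ : 0 < σ)
    (hw : ∀ c : EuclideanSpace ℝ ι, σ * ‖c‖ ≤ ‖∑ i, c i • w i‖)
    (hη : η * √(Fintype.card ι) ≤ σ / 2) (hη0 : 0 ≤ η) (c : EuclideanSpace ℝ ι)
    (hc : ∀ i ∉ J, c i = 0) : σ / 2 * ‖c‖ ≤ ‖P (∑ i, c i • w i)‖ := by
  obtain ⟨b, hb, hPb⟩ := hP.exists_eq (∑ i, c i • w i)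
  let d : EuclideanSpace ℝ ι := WithLp.toLp 2 fun i => c i - b i
  have hmono : ∀ e : ι → ℝ, (∀ i, e i ^ 2 ≤ d i ^ 2) → √(∑ i, e i ^ 2) ≤ ‖d‖ := fun e he => by
    rw [EuclideanSpace.norm_eq]
    refine Real.sqrt_le_sqrt (Finset.sum_le_sum fun i _ => ?_)
    rw [Real.norm_eq_abs, sq_abs]
    exact he i
  have hcd : ‖c‖ ≤ ‖d‖ := by
    have := hmono (fun i => c i) fun i => by
      by_cases hi : i ∈ J
      · simp [d, hb i hi]
      · simp [hc i hi, sq_nonneg]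
    simpa [EuclideanSpace.norm_eq c] using this
  have hbd : √(∑ i, b i ^ 2) ≤ ‖d‖ := hmono b fun i => by
    by_cases hi : i ∈ J
    · simp [hb i hi, sq_nonneg]
    · simp [d, hc i hi]
  have hb1 : ∑ i, |b i| ≤ √(Fintype.card ι) * ‖d‖ := by
    refine le_trans ?_ (mul_le_mul_of_nonneg_left hbd (Real.sqrt_nonneg _))
    rw [← Real.sqrt_mul (Nat.cast_nonneg _)]
    refine Real.le_sqrt_of_sq_le ?_
    simpa using sq_sum_le_card_mul_sum_sq (s := Finset.univ) (f := fun i => |b i|)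
  have hsplit : P (∑ i, c i • w i) = ∑ i, d i • w i + ∑ i, b i • (w i - x (g i)) := by
    rw [hPb, ← Finset.sum_add_distrib, ← Finset.sum_sub_distrib]
    refine Finset.sum_congr rfl fun i _ => ?_
    simp only [d]
    module
  have herr : ‖∑ i, b i • (w i - x (g i))‖ ≤ σ / 2 * ‖d‖ := by
    calc _ ≤ ∑ i, |b i| * η := by
          refine norm_sum_le_of_le _ fun i _ => ?_
          rw [norm_smul, Real.norm_eq_abs]
          by_cases hi : i ∈ J
          · simp [hb i hi]
          · exact mul_le_mul_of_nonneg_left (hP.dist_le i hi) (abs_nonneg _)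
      _ = η * ∑ i, |b i| := by rw [← Finset.sum_mul, mul_comm]
      _ ≤ η * (√(Fintype.card ι) * ‖d‖) := mul_le_mul_of_nonneg_left hb1 hη0
      _ = η * √(Fintype.card ι) * ‖d‖ := by ring
      _ ≤ _ := mul_le_mul_of_nonneg_right hη (norm_nonneg _)
  have := norm_sub_le_norm_add (∑ i, d i • w i) (∑ i, b i • (w i - x (g i)))
  rw [hsplit]
  nlinarith [hw d]

theorem orthComplProj_comp [DecidableEq ι] (hP : IsResidualMap w x η J g P) {i : ι} {k : κ}
    (hi : i ∈ J) (hk : ‖w i - x k‖ ≤ η) :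
    IsResidualMap w x η (J.erase i) (Function.update g i k)
      (orthComplProj (P (x k)) ∘ₗ P) where
  norm_le v := (norm_orthComplProj_le _ _).trans (hP.norm_le v)
  exists_eq v := by
    obtain ⟨b, hb, hPb⟩ := hP.exists_eq v
    obtain ⟨b', hb', hPb'⟩ := hP.exists_eq (x k)
    set t := inner ℝ (P (x k)) (P v) / inner ℝ (P (x k)) (P (x k)) with ht
    refine ⟨Function.update (fun l => b l - t * b' l) i t, fun l hl => ?_, ?_⟩
    · obtain ⟨hli, hl⟩ := Finset.mem_erase.1 hl
      simp [Function.update_of_ne hli, hb l hl, hb' l hl]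
    · have hsum : ∑ l, Function.update (fun l => b l - t * b' l) i t l •
          x (Function.update g i k l) =
          t • x k + ∑ l, (b l - t * b' l) • x (g l) := by
        rw [← Finset.add_sum_erase _ _ (Finset.mem_univ i),
          ← Finset.add_sum_erase _ (fun l => (b l - t * b' l) • x (g l)) (Finset.mem_univ i)]
        simp only [Function.update_self, hb i hi, hb' i hi, mul_zero, sub_zero, zero_smul, zero_add]
        congr 1
        refine Finset.sum_congr rfl fun l hl => ?_
        rw [Function.update_of_ne (Finset.ne_of_mem_erase hl),
          Function.update_of_ne (Finset.ne_of_mem_erase hl)]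
      rw [LinearMap.comp_apply, orthComplProj_apply, ← ht, hsum, hPb, hPb']
      simp only [sub_smul, mul_smul, Finset.sum_sub_distrib, ← Finset.smul_sum]
      module
  map_eq_zero l hl := by
    by_cases hli : l = i
    · subst hli
      rw [Function.update_self, LinearMap.comp_apply, orthComplProj_self]
    · rw [Function.update_of_ne hli, LinearMap.comp_apply, hP.map_eq_zero l, map_zero]
      exact fun h => hl (Finset.mem_erase.2 ⟨hli, h⟩)
  dist_le l hl := by
    by_cases hli : l = i
    · subst hli
      rwa [Function.update_self]
    · rw [Function.update_of_ne hli]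
      exact hP.dist_le l fun h => hl (Finset.mem_erase.2 ⟨hli, h⟩)

/-- One selection step: a column of maximal residual norm is close to a vertex not extracted yet. -/
theorem exists_dist_le [DecidableEq ι] (hP : IsResidualMap w x η J g P) (hJ : J.Nonempty)
    {σ L ε : ℝ} (hσ : 0 < σ) (hw : ∀ c : EuclideanSpace ℝ ι, σ * ‖c‖ ≤ ‖∑ i, c i • w i‖)
    (hL : ∀ i, ‖w i‖ ≤ L) (hη : η * √(Fintype.card ι) ≤ σ / 4) (hε : 0 ≤ ε)
    (hεη : ε + 128 * ε * (L / σ) ^ 2 ≤ η) (hpure : ∀ i, ∃ j, ‖x j - w i‖ ≤ ε)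
    {k : κ} (hk : ∀ j, ‖P (x j)‖ ≤ ‖P (x k)‖) (h : ι → ℝ) (h0 : ∀ i, 0 ≤ h i)
    (h1 : ∑ i, h i ≤ 1) (hx : ‖x k - ∑ i, h i • w i‖ ≤ ε) : ∃ i ∈ J, ‖w i - x k‖ ≤ η := by
  have hεη' : ε ≤ η := le_trans (le_add_of_nonneg_right (by positivity)) hεη
  have hη0 : 0 ≤ η := hε.trans hεη'
  have hησ : η ≤ σ / 4 := by
    obtain ⟨i, -⟩ := hJ
    have : 1 ≤ √(Fintype.card ι) := by
      rw [Real.one_le_sqrt]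
      exact_mod_cast Fintype.card_pos_iff.2 ⟨i⟩
    exact (le_mul_of_one_le_right hη0 this).trans hη
  have hlow := hP.le_norm_map hσ hw (hη.trans (by linarith)) hη0
  obtain ⟨i₀, hi₀, hmax⟩ := J.exists_max_image (fun i => ‖P (w i)‖) hJ
  have hσM : σ / 2 ≤ ‖P (w i₀)‖ := by
    have := hlow (EuclideanSpace.single i₀ 1) fun i hi => by
      have : i ≠ i₀ := fun e => hi (e ▸ hi₀)
      simp [this]
    simpa [Pi.single_apply] using this
  obtain ⟨i, hi, hwt⟩ := exists_weight_near_one J hJ (fun i => P (w i)) h h0 h1 (half_pos hσ) hσM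
    (hησ.trans (by linarith)) hmax (fun i hi => hP.norm_map_le hi) (by
      intro i hi j hj hij
      have h2 := hlow (EuclideanSpace.single i 1 - EuclideanSpace.single j 1) fun l hl => by
        have hli : l ≠ i := fun e => hl (e ▸ hi)
        have hlj : l ≠ j := fun e => hl (e ▸ hj)
        simp [hli, hlj]
      have h3 : ‖EuclideanSpace.single i (1 : ℝ) - EuclideanSpace.single j 1‖ ^ 2 = 2 := by
        rw [norm_sub_sq_real]
        simp [EuclideanSpace.inner_single_left, hij]
        norm_num
      have h4 := pow_le_pow_left₀ (by positivity) h2 2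
      rw [mul_pow, h3] at h4
      simp only [PiLp.sub_apply, sub_smul, Finset.sum_sub_distrib, map_sub] at h4
      simp at h4
      linarith)
  refine ⟨i, hi, ?_⟩
  have hwt' : (σ / 2) ^ 2 / 4 * (1 - h i) ≤ 4 * ε * L := by
    obtain ⟨j, hj⟩ := hpure i₀
    have e1 : ‖P (w i₀)‖ ≤ ‖P (x j)‖ + ε := by
      have := norm_le_norm_add_norm_sub (P (x j)) (P (w i₀))
      rw [← map_sub] at this
      linarith [hP.norm_le (x j - w i₀)]
    have e2 : ‖P (x k)‖ ≤ ‖∑ i, h i • P (w i)‖ + ε := by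
      have e3 : ∑ i, h i • P (w i) = P (∑ i, h i • w i) := by simp
      have := norm_le_norm_add_norm_sub (P (∑ i, h i • w i)) (P (x k))
      rw [norm_sub_rev, ← map_sub] at this
      rw [e3]
      linarith [hP.norm_le (x k - ∑ i, h i • w i)]
    have e4 : ‖P (w i₀)‖ - 2 * ε ≤ ‖∑ i, h i • P (w i)‖ := by linarith [hk j]
    have e5 := pow_le_pow_left₀ (by linarith) e4 2
    have e6 : ε * ‖P (w i₀)‖ ≤ ε * L :=
      mul_le_mul_of_nonneg_left ((hP.norm_le _).trans (hL _)) hε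
    nlinarith
  have hhi : h i ≤ ∑ l, h l := Finset.single_le_sum (fun i _ => h0 i) (Finset.mem_univ i)
  have hL0 : 0 ≤ L := (norm_nonneg _).trans (hL i)
  have hdist : ‖w i - ∑ l, h l • w l‖ ≤ 2 * (1 - h i) * L := by
    rw [← Finset.add_sum_erase _ _ (Finset.mem_univ i), ← sub_sub]
    have e1 : ‖w i - h i • w i‖ ≤ (1 - h i) * L := by
      have : w i - h i • w i = (1 - h i) • w i := by module
      rw [this, norm_smul, Real.norm_of_nonneg (by linarith)]
      exact mul_le_mul_of_nonneg_left (hL i) (by linarith)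
    have e2 : ‖∑ l ∈ Finset.univ.erase i, h l • w l‖ ≤ (1 - h i) * L := by
      calc _ ≤ ∑ l ∈ Finset.univ.erase i, h l * L := norm_sum_le_of_le _ fun l _ => by
            rw [norm_smul, Real.norm_of_nonneg (h0 l)]
            exact mul_le_mul_of_nonneg_left (hL l) (h0 l)
        _ = (∑ l ∈ Finset.univ.erase i, h l) * L := (Finset.sum_mul _ _ _).symm
        _ ≤ _ := by
            refine mul_le_mul_of_nonneg_right ?_ hL0
            have := Finset.add_sum_erase Finset.univ h (Finset.mem_univ i)
            linarith
    linarith [norm_sub_le (w i - h i • w i) (∑ l ∈ Finset.univ.erase i, h l • w l)]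
  have hgap : 2 * (1 - h i) * L ≤ 128 * ε * (L / σ) ^ 2 := by
    have e1 : 1 - h i ≤ 64 * ε * L / σ ^ 2 := by
      rw [le_div_iff₀ (by positivity)]
      nlinarith
    calc _ ≤ 2 * (64 * ε * L / σ ^ 2) * L := by gcongr
      _ = _ := by field_simp; ring
  have := norm_sub_le_norm_sub_add_norm_sub (w i) (∑ l, h l • w l) (x k)
  rw [norm_sub_rev (x k)] at hx
  linarith

end IsResidualMap

end Geometry

section Coordinates

variable {m n : ℕ}

/-- The `j`-th column of `X` as a point of Euclidean space. -/
noncomputable def euclideanCol (X : Matrix (Fin m) (Fin n) ℝ) (j : Fin n) :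
    EuclideanSpace ℝ (Fin m) :=
  WithLp.toLp 2 fun i => X i j

theorem colNorm_eq_norm (v : Fin m → ℝ) : colNorm v = ‖WithLp.toLp 2 v‖ := by
  simp [colNorm, EuclideanSpace.norm_eq]

theorem toLp_mulVec (X : Matrix (Fin m) (Fin n) ℝ) (v : Fin n → ℝ) :
    WithLp.toLp 2 (X.mulVec v) = ∑ j, v j • euclideanCol X j := by
  ext i
  simp [euclideanCol, Matrix.mulVec, dotProduct, mul_comm]

theorem euclideanCol_projOut (u : Fin m → ℝ) (X : Matrix (Fin m) (Fin n) ℝ) (j : Fin n) :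
    euclideanCol (projOut u X) j = orthComplProj (WithLp.toLp 2 u) (euclideanCol X j) := by
  ext i
  simp only [euclideanCol, projOut, orthComplProj_apply, PiLp.inner_apply, PiLp.sub_apply,
    PiLp.smul_apply, smul_eq_mul, RCLike.inner_apply, conj_trivial, mul_comm]

/-- The set of values `‖X v‖` on unit vectors is a continuous image of the unit sphere. -/
theorem setOf_colNorm_mulVec_eq_image (X : Matrix (Fin m) (Fin n) ℝ) :
    {c : ℝ | ∃ v : Fin n → ℝ, colNorm v = 1 ∧ c = colNorm (X.mulVec v)} =
      Set.image (fun v : EuclideanSpace ℝ (Fin n) => ‖∑ j, v j • euclideanCol X j‖)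
        (Metric.sphere 0 1) := by
  ext c
  simp only [Set.mem_ofPred_eq, Set.mem_image, mem_sphere_zero_iff_norm, colNorm_eq_norm,
    toLp_mulVec]
  constructor
  · rintro ⟨v, hv, rfl⟩
    exact ⟨WithLp.toLp 2 v, hv, rfl⟩
  · rintro ⟨v, hv, rfl⟩
    exact ⟨v.ofLp, hv, rfl⟩

theorem isCompact_setOf_colNorm_mulVec (X : Matrix (Fin m) (Fin n) ℝ) :
    IsCompact {c : ℝ | ∃ v : Fin n → ℝ, colNorm v = 1 ∧ c = colNorm (X.mulVec v)} := by
  rw [setOf_colNorm_mulVec_eq_image]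
  exact (isCompact_sphere 0 1).image (by fun_prop)

theorem sigmaMin_mul_norm_le (X : Matrix (Fin m) (Fin n) ℝ) (c : EuclideanSpace ℝ (Fin n)) :
    sigmaMin X * ‖c‖ ≤ ‖∑ j, c j • euclideanCol X j‖ := by
  by_cases hc : c = 0
  · simp [hc]
  have hc' : 0 < ‖c‖ := norm_pos_iff.2 hc
  rw [← le_div_iff₀ hc']
  refine csInf_le (isCompact_setOf_colNorm_mulVec X).bddBelow ?_
  rw [setOf_colNorm_mulVec_eq_image]
  refine ⟨‖c‖⁻¹ • c, by simp [norm_smul, hc'.ne'], ?_⟩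
  simp [mul_smul, ← Finset.smul_sum, norm_smul, div_eq_inv_mul]

theorem norm_euclideanCol_le_sigmaMax (X : Matrix (Fin m) (Fin n) ℝ) (j : Fin n) :
    ‖euclideanCol X j‖ ≤ sigmaMax X := by
  refine le_csSup (isCompact_setOf_colNorm_mulVec X).bddAbove ?_
  rw [setOf_colNorm_mulVec_eq_image]
  exact ⟨EuclideanSpace.single j 1, by simp, by simp⟩

theorem sigmaMin_pos (X : Matrix (Fin m) (Fin n) ℝ) (hn : 0 < n) (hX : X.rank = n) :
    0 < sigmaMin X := by
  have hne : {c : ℝ | ∃ v : Fin n → ℝ, colNorm v = 1 ∧ c = colNorm (X.mulVec v)}.Nonempty := by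
    rw [setOf_colNorm_mulVec_eq_image]
    exact Set.Nonempty.image _ ⟨EuclideanSpace.single ⟨0, hn⟩ 1, by simp⟩
  obtain ⟨v, hv, hmin⟩ := (isCompact_setOf_colNorm_mulVec X).sInf_mem hne
  rw [sigmaMin, hmin, colNorm_eq_norm, norm_pos_iff]
  intro h0
  have hinj : Function.Injective X.mulVec := by
    rw [Matrix.mulVec_injective_iff, linearIndependent_iff_card_eq_finrank_span,
      Fintype.card_fin]
    exact hX.symm.trans X.rank_eq_finrank_span_cols
  have hv0 : v = 0 := hinj (by
    rw [Matrix.mulVec_zero]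
    exact (WithLp.toLp_injective 2) h0)
  simp [hv0, colNorm] at hv

theorem NearSeparable.norm_sub_le {r : ℕ} {W : Matrix (Fin m) (Fin r) ℝ}
    {H : Matrix (Fin r) (Fin n) ℝ} {N Mt : Matrix (Fin m) (Fin n) ℝ} {ε : ℝ}
    (h : NearSeparable m n r W H N Mt ε) (j : Fin n) :
    ‖euclideanCol Mt j - ∑ i, H i j • euclideanCol W i‖ ≤ ε := by
  obtain ⟨rfl, -, -, -, -, -, hN⟩ := h
  have : euclideanCol (W * H + N) j - ∑ i, H i j • euclideanCol W i = euclideanCol N j := by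
    ext l
    simp [euclideanCol, Matrix.mul_apply, mul_comm]
  rw [this]
  exact (colNorm_eq_norm _).symm.trans_le (hN j)

/-- Robustness of the remaining steps of SPA, started from any residual. -/
theorem IsSPA.exists_dist_le {r s : ℕ} {X : Matrix (Fin m) (Fin n) ℝ} {K : Finset (Fin n)}
    (hK : IsSPA X s K) {w : Fin r → EuclideanSpace ℝ (Fin m)}
    {x : Fin n → EuclideanSpace ℝ (Fin m)} {H : Matrix (Fin r) (Fin n) ℝ} {σ L ε η : ℝ}
    (hσ : 0 < σ) (hw : ∀ c : EuclideanSpace ℝ (Fin r), σ * ‖c‖ ≤ ‖∑ i, c i • w i‖)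
    (hL : ∀ i, ‖w i‖ ≤ L) (hη : η * √r ≤ σ / 4) (hε : 0 ≤ ε)
    (hεη : ε + 128 * ε * (L / σ) ^ 2 ≤ η) (hpure : ∀ i, ∃ j, ‖x j - w i‖ ≤ ε)
    (h0 : ∀ i j, 0 ≤ H i j) (h1 : ∀ j, ∑ i, H i j ≤ 1)
    (hx : ∀ j, ‖x j - ∑ i, H i j • w i‖ ≤ ε) {J : Finset (Fin r)} {g : Fin r → Fin n}
    {P : EuclideanSpace ℝ (Fin m) →ₗ[ℝ] EuclideanSpace ℝ (Fin m)}
    (hP : IsResidualMap w x η J g P) (hX : ∀ j, euclideanCol X j = P (x j)) (hJ : J.card = s) :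
    ∀ i ∈ J, ∃ k ∈ K, ‖w i - x k‖ ≤ η := by
  induction hK generalizing J g P with
  | nil X => simp [Finset.card_eq_zero.1 hJ]
  | step X s k K hmax hK ih =>
    obtain ⟨i, hi, hik⟩ := hP.exists_dist_le (Finset.card_pos.1 (by omega)) hσ hw hL
      (by simpa using hη) hε hεη hpure (k := k)
      (fun j => by
        have := hmax j
        rw [colNorm_eq_norm, colNorm_eq_norm] at this
        rwa [← hX, ← hX]) (fun i => H i k)
      (fun i => h0 i k) (h1 k) (hx k)
    have hrest := ih (hP.orthComplProj_comp hi hik)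
      (fun j => by
        rw [euclideanCol_projOut, hX, LinearMap.comp_apply, ← hX k]
        rfl)
      (by rw [Finset.card_erase_of_mem hi, hJ, Nat.add_sub_cancel])
    intro l hl
    by_cases hli : l = i
    · exact ⟨k, Finset.mem_insert_self _ _, hli ▸ hik⟩
    · obtain ⟨k', hk', hd⟩ := hrest l (Finset.mem_erase.2 ⟨hli, hl⟩)
      exact ⟨k', Finset.mem_insert_of_mem hk', hd⟩

end Coordinates

/-- Theorem (Gillis–Vavasis): robustness of SPA on near-separable matrices. -/
theorem spa_robustness :
    ∃ c₁ > (0 : ℝ), ∃ c₂ > (0 : ℝ),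
      ∀ (m n r : ℕ) (W : Matrix (Fin m) (Fin r) ℝ) (H : Matrix (Fin r) (Fin n) ℝ)
        (N Mt : Matrix (Fin m) (Fin n) ℝ) (ε : ℝ) (K : Finset (Fin n)),
        NearSeparable m n r W H N Mt ε →
        ε ≤ c₁ * sigmaMin W / (Real.sqrt r * kappa W ^ 2) →
        IsSPA Mt r K →
        ∀ j : Fin r, ∃ k ∈ K,
          colNorm (fun i => W i j - Mt i k) ≤ c₂ * ε * kappa W ^ 2 := by
  refine ⟨1 / 516, by norm_num, 129, by norm_num, ?_⟩
  intro m n r W H N Mt ε K hsep hεle hK j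
  have hr : 0 < r := j.pos
  have hx := hsep.norm_sub_le
  obtain ⟨-, hrank, h0, h1, hpure, hε, -⟩ := hsep
  have hσ := sigmaMin_pos W hr hrank
  have hw := sigmaMin_mul_norm_le W
  have hL := norm_euclideanCol_le_sigmaMax W
  have hκ : 1 ≤ kappa W := by
    rw [kappa, one_le_div hσ]
    have := hw (EuclideanSpace.single j 1)
    simp at this
    exact this.trans (hL j)
  have hκ2 : 1 ≤ kappa W ^ 2 := one_le_pow₀ hκ
  have hr' : 0 < √(r : ℝ) := Real.sqrt_pos.2 (by exact_mod_cast hr)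
  have hη : 129 * ε * kappa W ^ 2 * √r ≤ sigmaMin W / 4 := by
    rw [le_div_iff₀ (by positivity)] at hεle
    linarith
  have hεη : ε + 128 * ε * (sigmaMax W / sigmaMin W) ^ 2 ≤ 129 * ε * kappa W ^ 2 := by
    change ε + 128 * ε * kappa W ^ 2 ≤ _
    nlinarith
  have hpure' : ∀ i, ∃ j, ‖euclideanCol Mt j - euclideanCol W i‖ ≤ ε := fun i => by
    obtain ⟨c, hc⟩ := hpure i
    refine ⟨c, ?_⟩
    simpa [hc] using hx c
  obtain ⟨c, -⟩ := hpure j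
  have hP : IsResidualMap (euclideanCol W) (euclideanCol Mt) (129 * ε * kappa W ^ 2)
      Finset.univ (fun _ => c) LinearMap.id :=
    { norm_le := fun _ => le_rfl
      exists_eq := fun v => ⟨0, by simp, by simp⟩
      map_eq_zero := by simp
      dist_le := by simp }
  obtain ⟨k, hk, hd⟩ := hK.exists_dist_le hσ hw hL hη hε hεη hpure' h0 h1 hx hP (fun _ => rfl)
    (by simp) j (Finset.mem_univ j)
  refine ⟨k, hk, ?_⟩
  rw [colNorm_eq_norm]
  exact hd
end

section
/- There exist universal constants c₁ > 0 and c₂ > 0 such that the following holds. For every near-separable instance M̃ = WH + N as in the assumption with m = r (so W ∈ ℝ^{r×r} is invertible), if ε ≤ c₁ · σ_min(W)/√r, then the index set K produced by SPA applied to the matrix W⁻¹M̃ with parameter r satisfies max_{1≤j≤r} min_{k∈K} ‖W(:,j) − M̃(:,k)‖₂ ≤ c₂ · ε · κ(W). -/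
open Matrix BigOperators

/-- An orthonormal family is stable under small perturbations: a vector orthogonal to `e j`, `j ∈ J`,
stays far from the span of vectors close to the `e j`. -/
theorem norm_le_norm_sub_sum_of_near_orthonormal {E : Type*} [NormedAddCommGroup E]
    [InnerProductSpace ℝ E] {r : ℕ} {e g : Fin r → E} (he : Orthonormal ℝ e) {J : Finset (Fin r)}
    {D : ℝ} (hD0 : 0 ≤ D) (hD : D * Real.sqrt r ≤ 1 / 10) (hg : ∀ j ∈ J, ‖g j - e j‖ ≤ D)
    {v : E} (hv : ∀ j ∈ J, inner ℝ v (e j) = 0) (a : Fin r → ℝ) :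
    9 / 10 * ‖v‖ ≤ ‖v - ∑ j ∈ J, a j • g j‖ := by
  set b := ∑ j ∈ J, a j • e j with hb
  have hvb : inner ℝ v b = 0 := by
    rw [hb, inner_sum]
    exact Finset.sum_eq_zero fun j hj => by rw [inner_smul_right, hv j hj, mul_zero]
  have hpyth : ‖v - b‖ ^ 2 = ‖v‖ ^ 2 + ‖b‖ ^ 2 := by
    rw [norm_sub_sq_real, hvb]; ring
  have hbsq : ‖b‖ ^ 2 = ∑ j ∈ J, a j ^ 2 := by
    rw [← real_inner_self_eq_norm_sq, hb, he.inner_sum]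
    exact Finset.sum_congr rfl fun j _ => by simp [sq]
  have hcs : ∑ j ∈ J, |a j| ≤ Real.sqrt r * ‖b‖ := by
    refine abs_le_of_sq_le_sq' ?_ (by positivity) |>.2
    rw [mul_pow, Real.sq_sqrt (Nat.cast_nonneg r), hbsq]
    have h1 := sq_sum_le_card_mul_sum_sq (s := J) (f := fun j => |a j|)
    simp only [sq_abs] at h1
    have h2 : (J.card : ℝ) ≤ r := by
      exact_mod_cast (Finset.card_le_univ J).trans_eq (Fintype.card_fin r)
    exact h1.trans (by gcongr)
  have hpert : ‖∑ j ∈ J, a j • (g j - e j)‖ ≤ 1 / 10 * ‖b‖ := by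
    calc ‖∑ j ∈ J, a j • (g j - e j)‖ ≤ ∑ j ∈ J, |a j| * D := by
          refine norm_sum_le_of_le _ fun j hj => ?_
          rw [norm_smul, Real.norm_eq_abs]
          exact mul_le_mul_of_nonneg_left (hg j hj) (abs_nonneg _)
      _ = D * ∑ j ∈ J, |a j| := by rw [← Finset.sum_mul, mul_comm]
      _ ≤ D * (Real.sqrt r * ‖b‖) := by gcongr
      _ = D * Real.sqrt r * ‖b‖ := by ring
      _ ≤ 1 / 10 * ‖b‖ := by gcongr
  have hsplit : v - ∑ j ∈ J, a j • g j = (v - b) - ∑ j ∈ J, a j • (g j - e j) := by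
    simp only [smul_sub, Finset.sum_sub_distrib, hb]; abel
  have htri := norm_sub_norm_le (v - b) (∑ j ∈ J, a j • (g j - e j))
  rw [← hsplit] at htri
  have h1 : ‖b‖ ≤ ‖v - b‖ := by
    refine abs_le_of_sq_le_sq' ?_ (norm_nonneg _) |>.2
    nlinarith [sq_nonneg ‖v‖]
  have h2 : ‖v‖ ≤ ‖v - b‖ := by
    refine abs_le_of_sq_le_sq' ?_ (norm_nonneg _) |>.2
    nlinarith [sq_nonneg ‖b‖]
  linarith

/-- Quantitative strict convexity: a subconvex combination of well separated vectors `w j`, `j ∉ J`,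
and of short vectors `w j`, `j ∈ J`, whose norm is nearly maximal, is nearly one of the
`w j` with `j ∉ J`. -/
theorem exists_weight_ge_of_norm_sum_ge {E : Type*} [NormedAddCommGroup E] [InnerProductSpace ℝ E]
    {ι : Type*} [Fintype ι] [DecidableEq ι] {w : ι → E} {J : Finset ι} (hJ : ∃ j, j ∉ J)
    {δ : ℝ} (hδ0 : 0 ≤ δ) (hδ : δ ≤ 1 / 200) {h : ι → ℝ} (h0 : ∀ j, 0 ≤ h j)
    (h1 : ∑ j, h j ≤ 1) (hle : ∀ j, ‖w j‖ ≤ 1) (hsmall : ∀ j ∈ J, ‖w j‖ ≤ 1 / 10)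
    (hlarge : ∀ j, j ∉ J → 9 / 10 ≤ ‖w j‖)
    (hsep : ∀ i j, i ∉ J → j ∉ J → i ≠ j → 144 / 100 ≤ ‖w i - w j‖ ^ 2)
    (hmax : ∀ j, j ∉ J → ‖w j‖ - 2 * δ ≤ ‖∑ i, h i • w i‖) :
    ∃ j, j ∉ J ∧ 1 - 9 * δ ≤ h j := by
  have hne : Jᶜ.Nonempty := hJ.imp fun j hj => Finset.mem_compl.2 hj
  obtain ⟨p, hp, hpmax⟩ := Finset.exists_max_image Jᶜ (fun j => ‖w j‖) hne
  obtain ⟨q, hq, hqmax⟩ := Finset.exists_max_image Jᶜ h hne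
  rw [Finset.mem_compl] at hp hq
  refine ⟨q, hq, ?_⟩
  set β := ∑ j ∈ Jᶜ, h j with hβ
  set S := ∑ j ∈ Jᶜ, h j • w j with hS
  have hp1 := hle p
  have hp9 := hlarge p hp
  have hpm := hmax p hp
  set μ := ‖w p‖ with hμ
  have hβ0 : 0 ≤ β := Finset.sum_nonneg fun j _ => h0 j
  have hsum : ∑ j ∈ J, h j + β = ∑ j, h j := Finset.sum_add_sum_compl J h
  have hα0 : 0 ≤ ∑ j ∈ J, h j := Finset.sum_nonneg fun j _ => h0 j
  have hsumw : ∑ j ∈ J, h j • w j + S = ∑ j, h j • w j :=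
    Finset.sum_add_sum_compl J fun j => h j • w j
  have hα : ‖∑ j ∈ J, h j • w j‖ ≤ (∑ j ∈ J, h j) * (1 / 10) := by
    rw [Finset.sum_mul]
    refine norm_sum_le_of_le _ fun j hj => ?_
    rw [norm_smul, Real.norm_of_nonneg (h0 j)]
    exact mul_le_mul_of_nonneg_left (hsmall j hj) (h0 j)
  have hSβ : ‖S‖ ≤ β * μ := by
    rw [hβ, Finset.sum_mul]
    refine norm_sum_le_of_le _ fun j hj => ?_
    rw [norm_smul, Real.norm_of_nonneg (h0 j)]
    exact mul_le_mul_of_nonneg_left (hpmax j hj) (h0 j)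
  have hSlow : μ - 2 * δ ≤ (1 - β) * (1 / 10) + ‖S‖ := by
    have := norm_add_le (∑ j ∈ J, h j • w j) S
    rw [hsumw] at this
    linarith
  have hβ1 : β ≤ 1 := by linarith
  have hβδ : 1 - β ≤ 5 / 2 * δ := by nlinarith
  have hSlow' : μ - 9 / 4 * δ ≤ ‖S‖ := by linarith
  have hinner : ∀ i ∈ Jᶜ, ∀ j ∈ Jᶜ,
      inner ℝ (w i) (w j) ≤ μ ^ 2 - 72 / 100 + (if i = j then 72 / 100 else 0) := by
    intro i hi j hj
    have hi2 : ‖w i‖ ^ 2 ≤ μ ^ 2 := by gcongr; exact hpmax i hi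
    have hj2 : ‖w j‖ ^ 2 ≤ μ ^ 2 := by gcongr; exact hpmax j hj
    split_ifs with hij
    · subst hij
      rw [real_inner_self_eq_norm_sq]; linarith
    · have := hsep i j (Finset.mem_compl.1 hi) (Finset.mem_compl.1 hj) hij
      rw [norm_sub_sq_real] at this
      linarith
  have hSsq : ‖S‖ ^ 2 ≤ β ^ 2 * (μ ^ 2 - 72 / 100) + 72 / 100 * ∑ j ∈ Jᶜ, h j ^ 2 := by
    calc ‖S‖ ^ 2 = ∑ i ∈ Jᶜ, ∑ j ∈ Jᶜ, h i * h j * inner ℝ (w i) (w j) := by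
          rw [← real_inner_self_eq_norm_sq, hS, sum_inner]
          refine Finset.sum_congr rfl fun i _ => ?_
          rw [inner_sum]
          refine Finset.sum_congr rfl fun j _ => ?_
          rw [real_inner_smul_left, real_inner_smul_right]; ring
      _ ≤ ∑ i ∈ Jᶜ, ∑ j ∈ Jᶜ,
            h i * h j * (μ ^ 2 - 72 / 100 + (if i = j then 72 / 100 else 0)) :=
          Finset.sum_le_sum fun i hi => Finset.sum_le_sum fun j hj =>
            mul_le_mul_of_nonneg_left (hinner i hi j hj) (mul_nonneg (h0 i) (h0 j))
      _ = β ^ 2 * (μ ^ 2 - 72 / 100) + 72 / 100 * ∑ j ∈ Jᶜ, h j ^ 2 := by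
          have hdiag : ∀ i ∈ Jᶜ, ∑ j ∈ Jᶜ, h i * h j * (if i = j then 72 / 100 else 0) =
              72 / 100 * h i ^ 2 := by
            intro i hi
            simp only [mul_ite, mul_zero, Finset.sum_ite_eq, if_pos hi]
            ring
          simp only [mul_add, Finset.sum_add_distrib]
          rw [Finset.sum_congr rfl hdiag, ← Finset.mul_sum]
          simp only [← Finset.sum_mul]
          rw [← Finset.sum_mul_sum, ← hβ, sq β]
  have hsq : ∑ j ∈ Jᶜ, h j ^ 2 ≤ h q * β := by
    rw [hβ, Finset.mul_sum]
    refine Finset.sum_le_sum fun j hj => ?_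
    rw [sq]
    exact mul_le_mul_of_nonneg_right (hqmax j hj) (h0 j)
  have hlow2 : (μ - 9 / 4 * δ) ^ 2 ≤ ‖S‖ ^ 2 := by
    have : 0 ≤ μ - 9 / 4 * δ := by linarith
    gcongr
  have hβμ : β ^ 2 * μ ^ 2 ≤ μ ^ 2 := by
    have : β ^ 2 ≤ 1 := by nlinarith
    nlinarith [sq_nonneg μ]
  have hfin : 72 / 100 * (β * (β - h q)) ≤ 9 / 2 * δ := by
    nlinarith [mul_nonneg hδ0 (sub_nonneg.2 hp1), sq_nonneg δ]
  by_contra! hlt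
  have hgap : 13 / 2 * δ < β - h q := by linarith
  have hβ98 : 98 / 100 ≤ β := by linarith
  nlinarith [mul_le_mul_of_nonneg_right hβ98 (by linarith : 0 ≤ β - h q)]

theorem colNorm_eq_norm_toLp {m : ℕ} (v : Fin m → ℝ) : colNorm v = ‖WithLp.toLp 2 v‖ := by
  simp [colNorm, EuclideanSpace.norm_eq]

theorem toLp_projOut_col {m n : ℕ} (u : Fin m → ℝ) (X : Matrix (Fin m) (Fin n) ℝ) (j : Fin n) :
    WithLp.toLp 2 (fun i => projOut u X i j) =
      WithLp.toLp 2 (fun i => X i j) -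
        (inner ℝ (WithLp.toLp 2 u) (WithLp.toLp 2 (fun i => X i j)) /
          inner ℝ (WithLp.toLp 2 u) (WithLp.toLp 2 u)) • WithLp.toLp 2 u := by
  ext i
  simp only [projOut, PiLp.sub_apply, PiLp.smul_apply, PiLp.inner_apply, RCLike.inner_apply,
    conj_trivial, smul_eq_mul, mul_comm]

/-- Removing from a linear map the component of its values along `u`. -/
noncomputable def LinearMap.deflate {E : Type*} [NormedAddCommGroup E] [InnerProductSpace ℝ E]
    (P : E →ₗ[ℝ] E) (u : E) : E →ₗ[ℝ] E where
  toFun v := P v - (inner ℝ u (P v) / inner ℝ u u) • u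
  map_add' v w := by
    rw [map_add, inner_add_right, add_div, add_smul]; abel
  map_smul' c v := by
    simp only [map_smul, real_inner_smul_right, RingHom.id_apply, smul_sub, smul_smul, mul_div_assoc]

theorem norm_sub_inner_div_smul_le {E : Type*} [NormedAddCommGroup E] [InnerProductSpace ℝ E]
    (u v : E) : ‖v - (inner ℝ u v / inner ℝ u u) • u‖ ≤ ‖v‖ := by
  refine abs_le_of_sq_le_sq' ?_ (norm_nonneg _) |>.2
  rcases eq_or_ne u 0 with rfl | hu
  · simp
  have hpos : 0 < inner ℝ u u := real_inner_self_pos.2 hu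
  rw [norm_sub_sq_real, norm_smul, mul_pow, ← real_inner_self_eq_norm_sq u, real_inner_smul_right,
    real_inner_comm u v, Real.norm_eq_abs, sq_abs]
  have : inner ℝ u v / inner ℝ u u * inner ℝ u u = inner ℝ u v := div_mul_cancel₀ _ hpos.ne'
  have h2 : 0 ≤ inner ℝ u v / inner ℝ u u * inner ℝ u v := by
    rw [div_mul_eq_mul_div]; exact div_nonneg (mul_self_nonneg _) hpos.le
  rw [sq (_ / _), mul_assoc (_ / _) (_ / _), this]
  linarith

/-- Robustness of the remaining steps of the algorithm, for data `x` close to subconvex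
combinations of an orthonormal family `e`, once the vectors `e j`, `j ∈ J`, have been
approximated by vectors `g j` and projected out by `P`. -/
theorem IsSPA.exists_near_of_residual {m n r : ℕ} {e : Fin r → EuclideanSpace ℝ (Fin m)}
    (he : Orthonormal ℝ e) {x : Fin n → EuclideanSpace ℝ (Fin m)} {δ : ℝ} (hδ0 : 0 ≤ δ)
    (hδ : δ ≤ 1 / 200) (hδr : 20 * δ * Real.sqrt r ≤ 1 / 10) {H : Matrix (Fin r) (Fin n) ℝ}
    (hH0 : ∀ i j, 0 ≤ H i j) (hH1 : ∀ j, ∑ i, H i j ≤ 1)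
    (hHe : ∀ j : Fin r, ∃ c : Fin n, ∀ i, H i c = if i = j then 1 else 0)
    (hx : ∀ k, ‖x k - ∑ i, H i k • e i‖ ≤ δ)
    {X : Matrix (Fin m) (Fin n) ℝ} {s : ℕ} {K : Finset (Fin n)} (hK : IsSPA X s K)
    (J : Finset (Fin r)) (hJ : J.card + s = r)
    (P : EuclideanSpace ℝ (Fin m) →ₗ[ℝ] EuclideanSpace ℝ (Fin m))
    (hP : ∀ v, ‖P v‖ ≤ ‖v‖) (hX : ∀ k, WithLp.toLp 2 (fun i => X i k) = P (x k))
    (g : Fin r → EuclideanSpace ℝ (Fin m)) (hg : ∀ j ∈ J, ‖g j - e j‖ ≤ 20 * δ)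
    (hPg : ∀ j ∈ J, P (g j) = 0)
    (hspan : ∀ v, v - P v ∈ Submodule.span ℝ (g '' J)) :
    ∀ j, j ∉ J → ∃ k ∈ K, ‖x k - e j‖ ≤ 20 * δ := by
  induction hK generalizing J P g with
  | nil X =>
    intro j hj
    have : J = Finset.univ := by
      rw [← Finset.card_eq_iff_eq_univ, Fintype.card_fin]; simpa using hJ
    exact absurd (this ▸ Finset.mem_univ j) hj
  | step X s k K hmax _ ih =>
    have hge : ∀ v, (∀ j ∈ J, inner ℝ v (e j) = 0) → 9 / 10 * ‖v‖ ≤ ‖P v‖ := by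
      intro v hv
      obtain ⟨a, ha⟩ := (Submodule.mem_span_image_finset_iff_exists_fun' ℝ).1 (hspan v)
      have := norm_le_norm_sub_sum_of_near_orthonormal he (by positivity) hδr hg hv a
      rwa [ha, sub_sub_cancel] at this
    have hJne : ∃ j, j ∉ J := by
      by_contra! hall
      rw [Finset.eq_univ_of_forall hall, Finset.card_fin] at hJ
      omega
    have hnoise : ∀ k, ‖P (x k) - ∑ i, H i k • P (e i)‖ ≤ δ := by
      intro k
      have : P (x k) - ∑ i, H i k • P (e i) = P (x k - ∑ i, H i k • e i) := by
        simp only [map_sub, map_sum, map_smul]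
      exact this ▸ (hP _).trans (hx k)
    have horth : ∀ i j, i ≠ j → inner ℝ (e i) (e j) = 0 := fun i j hij => he.2 hij
    obtain ⟨j₀, hj₀, hweight⟩ : ∃ j, j ∉ J ∧ 1 - 9 * δ ≤ H j k := by
      refine exists_weight_ge_of_norm_sum_ge (w := fun i => P (e i)) hJne hδ0 hδ
        (fun i => hH0 i k) (hH1 k) (fun j => (hP _).trans_eq (he.1 j)) ?_ ?_ ?_ ?_
      · intro j hj
        have : P (e j) = - P (g j - e j) := by rw [map_sub, hPg j hj]; simp
        rw [this, norm_neg]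
        exact (hP _).trans ((hg j hj).trans (by linarith))
      · intro j hj
        have := hge (e j) fun i hi => horth j i (by rintro rfl; exact hj hi)
        rwa [he.1 j, mul_one] at this
      · intro i j hi hj hij
        have h1 := hge (e i - e j) fun l hl => by
          rw [inner_sub_left, horth i l (by rintro rfl; exact hi hl),
            horth j l (by rintro rfl; exact hj hl), sub_zero]
        have h2 : ‖e i - e j‖ ^ 2 = 2 := by
          rw [norm_sub_sq_real, he.1 i, he.1 j, horth i j hij]; norm_num
        rw [map_sub] at h1
        have h3 := pow_le_pow_left₀ (by positivity) h1 2
        rw [mul_pow, h2] at h3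
        linarith
      · intro j _
        obtain ⟨c, hc⟩ := hHe j
        have h1 := hmax c
        rw [colNorm_eq_norm_toLp, colNorm_eq_norm_toLp, hX, hX] at h1
        have h2 : ∑ i, H i c • P (e i) = P (e j) := by simp [hc]
        have h3 := hnoise c
        rw [h2, norm_sub_rev] at h3
        have h4 := norm_sub_norm_le (P (e j)) (P (x c))
        have h5 := norm_sub_norm_le (P (x k)) (∑ i, H i k • P (e i))
        have h6 := hnoise k
        linarith
    have hnear : ‖x k - e j₀‖ ≤ 20 * δ := by
      have hrest : ∑ i, H i k • e i - e j₀ =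
          ∑ i ∈ Finset.univ.erase j₀, H i k • e i + (H j₀ k - 1) • e j₀ := by
        rw [← Finset.add_sum_erase _ _ (Finset.mem_univ j₀), sub_smul, one_smul]; abel
      have hsum := Finset.add_sum_erase Finset.univ (fun i => H i k) (Finset.mem_univ j₀)
      have h1 : ‖∑ i ∈ Finset.univ.erase j₀, H i k • e i‖ ≤
          ∑ i ∈ Finset.univ.erase j₀, H i k :=
        norm_sum_le_of_le _ fun i _ => by
          rw [norm_smul, he.1 i, mul_one, Real.norm_of_nonneg (hH0 i k)]
      have h0 : 0 ≤ ∑ i ∈ Finset.univ.erase j₀, H i k := Finset.sum_nonneg fun i _ => hH0 i k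
      have h1' := hH1 k
      have h2 : ‖(H j₀ k - 1) • e j₀‖ = 1 - H j₀ k := by
        rw [norm_smul, he.1, mul_one, Real.norm_of_nonpos (by linarith)]; ring
      have h3 := norm_add_le (∑ i ∈ Finset.univ.erase j₀, H i k • e i) ((H j₀ k - 1) • e j₀)
      rw [← hrest] at h3
      have h4 := norm_sub_le_norm_sub_add_norm_sub (x k) (∑ i, H i k • e i) (e j₀)
      have h5 := hx k
      linarith
    have hgne : ∀ j ∈ J, Function.update g j₀ (x k) j = g j := fun j hj =>
      Function.update_of_ne (by rintro rfl; exact hj₀ hj) _ _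
    have hmono : Submodule.span ℝ (g '' J) ≤
        Submodule.span ℝ (Function.update g j₀ (x k) '' (insert j₀ J : Finset (Fin r))) := by
      refine Submodule.span_mono ?_
      rintro _ ⟨j, hj, rfl⟩
      exact ⟨j, by simp [Finset.mem_coe.1 hj], hgne j hj⟩
    have hxk : P (x k) ∈
        Submodule.span ℝ (Function.update g j₀ (x k) '' (insert j₀ J : Finset (Fin r))) := by
      rw [← sub_sub_cancel (x k) (P (x k))]
      refine Submodule.sub_mem _ (Submodule.subset_span ⟨j₀, by simp, by simp⟩) (hmono (hspan _))
    have key := ih (insert j₀ J) (by rw [Finset.card_insert_of_notMem hj₀]; omega)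
      (P.deflate (P (x k))) (fun v => (norm_sub_inner_div_smul_le _ _).trans (hP v))
      (fun l => by rw [toLp_projOut_col, hX, hX]; rfl)
      (Function.update g j₀ (x k))
      (by
        intro j hj
        rcases Finset.mem_insert.1 hj with rfl | hj
        · simpa using hnear
        · rw [hgne j hj]; exact hg j hj)
      (by
        intro j hj
        rcases Finset.mem_insert.1 hj with rfl | hj
        · rw [Function.update_self]
          change P (x k) - (inner ℝ (P (x k)) (P (x k)) / inner ℝ (P (x k)) (P (x k))) • P (x k) = 0
          rcases eq_or_ne (P (x k)) 0 with h | h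
          · simp [h]
          · rw [div_self (real_inner_self_pos.2 h).ne', one_smul, sub_self]
        · rw [hgne j hj]
          change P (g j) - (inner ℝ (P (x k)) (P (g j)) / inner ℝ (P (x k)) (P (x k))) • P (x k) = 0
          simp [hPg j hj])
      (by
        intro v
        change v - (P v - (inner ℝ (P (x k)) (P v) / inner ℝ (P (x k)) (P (x k))) • P (x k)) ∈ _
        rw [← sub_add]
        exact Submodule.add_mem _ (hmono (hspan v)) (Submodule.smul_mem _ _ hxk))
    intro j hj
    rcases eq_or_ne j j₀ with rfl | hne
    · exact ⟨k, Finset.mem_insert_self _ _, hnear⟩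
    · obtain ⟨l, hl, hl'⟩ := key j (by simp [hne, hj])
      exact ⟨l, Finset.mem_insert_of_mem hl, hl'⟩

theorem colNorm_nonneg {m : ℕ} (v : Fin m → ℝ) : 0 ≤ colNorm v := Real.sqrt_nonneg _

theorem colNorm_smul {m : ℕ} (c : ℝ) (v : Fin m → ℝ) : colNorm (c • v) = |c| * colNorm v := by
  rw [colNorm_eq_norm_toLp, colNorm_eq_norm_toLp, WithLp.toLp_smul, norm_smul, Real.norm_eq_abs]

theorem colNorm_eq_zero {m : ℕ} {v : Fin m → ℝ} : colNorm v = 0 ↔ v = 0 := by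
  rw [colNorm_eq_norm_toLp, norm_eq_zero, WithLp.toLp_eq_zero]

theorem exists_colNorm_mulVec_le {m n : ℕ} (A : Matrix (Fin m) (Fin n) ℝ) :
    ∃ L > 0, ∀ v, colNorm (A.mulVec v) ≤ L * colNorm v := by
  obtain ⟨L, hL, h⟩ := (LinearMap.toContinuousLinearMap (Matrix.toEuclideanLin A)).bound
  refine ⟨L, hL, fun v => ?_⟩
  rw [colNorm_eq_norm_toLp, colNorm_eq_norm_toLp]
  exact h (WithLp.toLp 2 v)

theorem exists_unit_colNorm_mulVec {m n : ℕ} (A : Matrix (Fin m) (Fin n) ℝ) {v : Fin n → ℝ}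
    (hv : v ≠ 0) :
    ∃ u, colNorm u = 1 ∧ colNorm (A.mulVec v) = colNorm (A.mulVec u) * colNorm v := by
  have h0 : colNorm v ≠ 0 := mt colNorm_eq_zero.1 hv
  have hpos : 0 < colNorm v := (colNorm_nonneg v).lt_of_ne' h0
  refine ⟨(colNorm v)⁻¹ • v, ?_, ?_⟩
  · rw [colNorm_smul, abs_of_pos (inv_pos.2 hpos), inv_mul_cancel₀ h0]
  · rw [Matrix.mulVec_smul, colNorm_smul, abs_of_pos (inv_pos.2 hpos)]
    field_simp

theorem colNorm_mulVec_le_sigmaMax {m n : ℕ} (A : Matrix (Fin m) (Fin n) ℝ) (v : Fin n → ℝ) :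
    colNorm (A.mulVec v) ≤ sigmaMax A * colNorm v := by
  rcases eq_or_ne v 0 with rfl | hv
  · simp [colNorm]
  obtain ⟨u, hu, h⟩ := exists_unit_colNorm_mulVec A hv
  rw [h]
  refine mul_le_mul_of_nonneg_right (le_csSup ?_ ⟨u, hu, rfl⟩) (colNorm_nonneg v)
  obtain ⟨L, -, hL⟩ := exists_colNorm_mulVec_le A
  refine ⟨L, ?_⟩
  rintro _ ⟨w, hw, rfl⟩
  simpa [hw] using hL w

theorem sigmaMin_mul_colNorm_le {m n : ℕ} (A : Matrix (Fin m) (Fin n) ℝ) (v : Fin n → ℝ) :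
    sigmaMin A * colNorm v ≤ colNorm (A.mulVec v) := by
  rcases eq_or_ne v 0 with rfl | hv
  · simp [colNorm]
  obtain ⟨u, hu, h⟩ := exists_unit_colNorm_mulVec A hv
  rw [h]
  refine mul_le_mul_of_nonneg_right (csInf_le ?_ ⟨u, hu, rfl⟩) (colNorm_nonneg v)
  refine ⟨0, ?_⟩
  rintro _ ⟨w, -, rfl⟩
  exact colNorm_nonneg _

theorem sigmaMin_pos_of_isUnit_det {r : ℕ} (hr : 0 < r) {W : Matrix (Fin r) (Fin r) ℝ}
    (hW : IsUnit W.det) : 0 < sigmaMin W := by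
  obtain ⟨L, hL0, hL⟩ := exists_colNorm_mulVec_le W⁻¹
  refine (inv_pos.2 hL0).trans_le (le_csInf ?_ ?_)
  · exact ⟨_, Pi.single ⟨0, hr⟩ 1, by simp [colNorm_eq_norm_toLp], rfl⟩
  · rintro _ ⟨v, hv, rfl⟩
    have := hL (W.mulVec v)
    rw [Matrix.mulVec_mulVec, Matrix.nonsing_inv_mul W hW, Matrix.one_mulVec, hv] at this
    rwa [inv_le_iff_one_le_mul₀' hL0]

theorem toLp_col_add_sub_sum_single {r n : ℕ} (H A : Matrix (Fin r) (Fin n) ℝ) (k : Fin n) :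
    WithLp.toLp 2 (fun i => (H + A) i k) - ∑ i, H i k • EuclideanSpace.single i (1 : ℝ) =
      WithLp.toLp 2 (fun i => A i k) := by
  ext l
  simp [Pi.single_apply]

/-- Corollary: robustness of SPA applied to the ideally preconditioned matrix `W⁻¹ * Mt`. -/
theorem ideal_preconditioned_spa_robustness :
    ∃ c₁ > (0 : ℝ), ∃ c₂ > (0 : ℝ),
      ∀ (n r : ℕ) (W : Matrix (Fin r) (Fin r) ℝ) (H : Matrix (Fin r) (Fin n) ℝ)
        (N Mt : Matrix (Fin r) (Fin n) ℝ) (ε : ℝ) (K : Finset (Fin n)),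
        NearSeparable r n r W H N Mt ε →
        ε ≤ c₁ * sigmaMin W / Real.sqrt r →
        IsSPA (W⁻¹ * Mt) r K →
        ∀ j : Fin r, ∃ k ∈ K,
          colNorm (fun i => W i j - Mt i k) ≤ c₂ * ε * kappa W := by
  refine ⟨1 / 200, by norm_num, 20, by norm_num, ?_⟩
  rintro n r W H N Mt ε K ⟨rfl, hrank, hH0, hH1, hHe, hε0, hN⟩ hε hK j
  have hr : 0 < r := j.pos
  have hdet : IsUnit W.det := by
    rw [← Matrix.isUnit_iff_isUnit_det, ← Matrix.mulVec_surjective_iff_isUnit]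
    exact LinearMap.range_eq_top.1
      (Submodule.eq_top_of_finrank_eq (S := W.mulVecLin.range) (hrank.trans (by simp)))
  have hσ := sigmaMin_pos_of_isUnit_det hr hdet
  have hprec : W⁻¹ * (W * H + N) = H + W⁻¹ * N := by
    rw [Matrix.mul_add, Matrix.nonsing_inv_mul_cancel_left _ _ hdet]
  have hcol : ∀ k, (fun i => (W⁻¹ * N) i k) = W⁻¹.mulVec (fun i => N i k) := fun k => rfl
  have hsqrt : 1 ≤ Real.sqrt r := by
    rw [Real.one_le_sqrt]; exact_mod_cast hr
  have hδ0 : 0 ≤ ε / sigmaMin W := by positivity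
  have hδr : ε / sigmaMin W * Real.sqrt r ≤ 1 / 200 := by
    rw [le_div_iff₀ (by linarith)] at hε
    rw [div_mul_eq_mul_div, div_le_iff₀ hσ]
    exact hε
  have hnoise : ∀ k, colNorm (fun i => (W⁻¹ * N) i k) ≤ ε / sigmaMin W := by
    intro k
    rw [le_div_iff₀ hσ, mul_comm, hcol]
    refine (sigmaMin_mul_colNorm_le W _).trans ?_
    rw [Matrix.mulVec_mulVec, Matrix.mul_nonsing_inv W hdet, Matrix.one_mulVec]
    exact hN k
  rw [hprec] at hK
  obtain ⟨k, hk, hnear⟩ := hK.exists_near_of_residual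
    (e := fun i => EuclideanSpace.single i (1 : ℝ))
    (x := fun k => WithLp.toLp 2 (fun i => (H + W⁻¹ * N) i k))
    EuclideanSpace.orthonormal_single hδ0 (by nlinarith) (by linarith) hH0 hH1 hHe
    (fun k => by rw [toLp_col_add_sub_sum_single, ← colNorm_eq_norm_toLp]; exact hnoise k)
    ∅ (by simp) LinearMap.id (fun _ => le_rfl) (fun _ => rfl) 0 (by simp) (by simp) (by simp)
    j (by simp)
  refine ⟨k, hk, ?_⟩
  have hdiff : (fun i => W i j - (W * H + N) i k) =
      W.mulVec (Pi.single j 1 - fun i => (H + W⁻¹ * N) i k) := by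
    have h1 : W.mulVec (fun i => (H + W⁻¹ * N) i k) = fun i => (W * (H + W⁻¹ * N)) i k := rfl
    rw [Matrix.mulVec_sub, h1, Matrix.mul_add, Matrix.mul_nonsing_inv_cancel_left _ _ hdet]
    ext i
    simp
  have hnear' : colNorm (Pi.single j 1 - fun i => (H + W⁻¹ * N) i k) ≤
      20 * (ε / sigmaMin W) := by
    rw [colNorm_eq_norm_toLp, WithLp.toLp_sub, norm_sub_rev]
    exact hnear
  have hmax0 : 0 ≤ sigmaMax W :=
    Real.sSup_nonneg fun c ⟨v, _, hc⟩ => hc ▸ colNorm_nonneg _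
  rw [hdiff]
  calc _ ≤ sigmaMax W * colNorm (Pi.single j 1 - fun i => (H + W⁻¹ * N) i k) :=
        colNorm_mulVec_le_sigmaMax W _
    _ ≤ sigmaMax W * (20 * (ε / sigmaMin W)) := by gcongr
    _ = 20 * ε * kappa W := by rw [kappa]; ring
end

section
/- In the noiseless separable case (N = 0, so M̃ = M = WH), the matrix A* = (WWᵀ)⁻¹ is an optimal solution of the minimum-volume-ellipsoid SDP: it is positive semidefinite, satisfies m_iᵀ A* m_i ≤ 1 for every column m_i of M, and every positive semidefinite matrix A with m_iᵀ A m_i ≤ 1 for all i satisfies det(A) ≤ det((WWᵀ)⁻¹). -/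
open Matrix BigOperators

/-- Largest eigenvalue of a symmetric matrix, via the Rayleigh quotient. -/
noncomputable def lamMax {r : ℕ} (C : Matrix (Fin r) (Fin r) ℝ) : ℝ :=
  sSup {c : ℝ | ∃ v : Fin r → ℝ, colNorm v = 1 ∧ c = v ⬝ᵥ C.mulVec v}

/-- Smallest eigenvalue of a symmetric matrix, via the Rayleigh quotient. -/
noncomputable def lamMin {r : ℕ} (C : Matrix (Fin r) (Fin r) ℝ) : ℝ :=
  sInf {c : ℝ | ∃ v : Fin r → ℝ, colNorm v = 1 ∧ c = v ⬝ᵥ C.mulVec v}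

/-- Near-separable assumption with `m = r`: `Mt = W * H + N` where `W ∈ ℝ^{r×r}` is
invertible, `H = [I_r, H']` is nonnegative with column sums at most one and whose first `r`
columns form the identity matrix, and each column of `N` has Euclidean norm at most `ε`. -/
def NearSepSquare (r n : ℕ) (W : Matrix (Fin r) (Fin r) ℝ) (H : Matrix (Fin r) (Fin n) ℝ)
    (N Mt : Matrix (Fin r) (Fin n) ℝ) (ε : ℝ) : Prop :=
  IsUnit W.det ∧ Mt = W * H + N ∧ (∀ i j, 0 ≤ H i j) ∧ (∀ j, ∑ i, H i j ≤ 1) ∧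
    (∃ h : r ≤ n, ∀ i j : Fin r, H i (Fin.castLE h j) = if i = j then 1 else 0) ∧
    0 ≤ ε ∧ ∀ j, colNorm (fun i => N i j) ≤ ε

/-- `A` is feasible for the minimum-volume-ellipsoid SDP associated with `Mt`:
`A` is positive semidefinite and `m̃ᵢᵀ A m̃ᵢ ≤ 1` for every column `m̃ᵢ` of `Mt`. -/
def SDPFeasible {r n : ℕ} (Mt : Matrix (Fin r) (Fin n) ℝ)
    (A : Matrix (Fin r) (Fin r) ℝ) : Prop :=
  A.PosSemidef ∧ ∀ j : Fin n, (fun i => Mt i j) ⬝ᵥ A.mulVec (fun i => Mt i j) ≤ 1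

/-- `A` is an optimal solution of the minimum-volume-ellipsoid SDP associated with `Mt`:
it is feasible and maximizes the determinant among the feasible matrices. -/
def SDPOptimal {r n : ℕ} (Mt : Matrix (Fin r) (Fin n) ℝ)
    (A : Matrix (Fin r) (Fin r) ℝ) : Prop :=
  SDPFeasible Mt A ∧ ∀ B : Matrix (Fin r) (Fin r) ℝ, SDPFeasible Mt B → B.det ≤ A.det

/-- A positive semidefinite real matrix whose trace is at most its size has determinant at most
one. -/
theorem Matrix.PosSemidef.det_le_one_of_trace_le {ι : Type*} [Fintype ι] [DecidableEq ι]
    {C : Matrix ι ι ℝ} (hC : C.PosSemidef) (htr : C.trace ≤ Fintype.card ι) : C.det ≤ 1 := by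
  have hdet : C.det = ∏ i, hC.isHermitian.eigenvalues i := by
    simpa using hC.isHermitian.det_eq_prod_eigenvalues
  have htrace : C.trace = ∑ i, hC.isHermitian.eigenvalues i := by
    simpa using hC.isHermitian.trace_eq_sum_eigenvalues
  calc C.det = ∏ i, hC.isHermitian.eigenvalues i := hdet
    _ ≤ ∏ i, Real.exp (hC.isHermitian.eigenvalues i - 1) :=
        Finset.prod_le_prod (fun i _ => hC.eigenvalues_nonneg i) fun i _ => by
          linarith [Real.add_one_le_exp (hC.isHermitian.eigenvalues i - 1)]
    _ = Real.exp (C.trace - Fintype.card ι) := by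
        rw [← Real.exp_sum, htrace, Finset.sum_sub_distrib]
        simp
    _ ≤ 1 := Real.exp_le_one_iff.mpr (sub_nonpos.mpr htr)

/-- A nonnegative vector with entries summing to at most one has squared Euclidean norm at most
one. -/
theorem dotProduct_self_le_one_of_sum_le_one {ι : Type*} [Fintype ι] {v : ι → ℝ}
    (hv : ∀ i, 0 ≤ v i) (hsum : ∑ i, v i ≤ 1) : v ⬝ᵥ v ≤ 1 := by
  refine le_trans (Finset.sum_le_sum fun i _ => ?_) hsum
  have hle : v i ≤ 1 :=
    (Finset.single_le_sum (fun k _ => hv k) (Finset.mem_univ i)).trans hsum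
  exact mul_le_of_le_one_right (hv i) hle

/-- Pulling a quadratic form back along a matrix. -/
theorem mulVec_dotProduct_mulVec_mulVec {m n R : Type*} [Fintype m] [Fintype n] [CommRing R]
    (W : Matrix m n R) (A : Matrix m m R) (v : n → R) :
    (W *ᵥ v) ⬝ᵥ (A *ᵥ (W *ᵥ v)) = v ⬝ᵥ ((Wᵀ * A * W) *ᵥ v) := by
  rw [← Matrix.mulVec_mulVec, ← Matrix.mulVec_mulVec, Matrix.dotProduct_mulVec v Wᵀ,
    Matrix.vecMul_transpose]

/-- In the noiseless separable case, `A* = (WWᵀ)⁻¹` is an optimal solution of the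
minimum-volume-ellipsoid SDP. -/
theorem noiseless_optimal_solution (r n : ℕ) (W : Matrix (Fin r) (Fin r) ℝ)
    (H : Matrix (Fin r) (Fin n) ℝ) (Mt : Matrix (Fin r) (Fin n) ℝ)
    (hsep : NearSepSquare r n W H 0 Mt 0) :
    SDPOptimal Mt (W * Wᵀ)⁻¹ := by
  obtain ⟨hW, rfl, hH, hsum, ⟨hrn, hI⟩, -⟩ := hsep
  rw [add_zero]
  have hcol (j : Fin n) : (fun i => (W * H) i j) = W *ᵥ (fun i => H i j) := rfl
  have hWT : IsUnit Wᵀ.det := by rwa [Matrix.det_transpose]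
  refine ⟨⟨?_, fun j => ?_⟩, fun B hB => ?_⟩
  · simpa using (Matrix.posSemidef_self_mul_conjTranspose W).inv
  · have hone : Wᵀ * (W * Wᵀ)⁻¹ * W = 1 := by
      rw [Matrix.mul_inv_rev, ← Matrix.mul_assoc, Matrix.mul_nonsing_inv _ hWT, Matrix.one_mul,
        Matrix.nonsing_inv_mul _ hW]
    rw [hcol, mulVec_dotProduct_mulVec_mulVec, hone, Matrix.one_mulVec]
    exact dotProduct_self_le_one_of_sum_le_one (fun i => hH i j) (hsum j)
  · have hpsd : (Wᵀ * B * W).PosSemidef := by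
      simpa using hB.1.conjTranspose_mul_mul_same W
    have hdiag (k : Fin r) : (Wᵀ * B * W) k k ≤ 1 := by
      have hk := hB.2 (Fin.castLE hrn k)
      have hHk : (fun i => H i (Fin.castLE hrn k)) = Pi.single k 1 := by
        ext i
        rw [hI, Pi.single_apply]
      rw [hcol, mulVec_dotProduct_mulVec_mulVec, hHk] at hk
      simpa using hk
    have hdet : (Wᵀ * B * W).det ≤ 1 := hpsd.det_le_one_of_trace_le <| by
      simpa [Matrix.trace] using Finset.sum_le_sum fun k (_ : k ∈ Finset.univ) => hdiag k
    have hpos : 0 < W.det * W.det := mul_self_pos.mpr hW.ne_zero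
    rw [Matrix.det_nonsing_inv, Ring.inverse_eq_inv', Matrix.det_mul, Matrix.det_transpose,
      ← one_div, le_div_iff₀ hpos]
    rw [Matrix.det_mul, Matrix.det_mul, Matrix.det_transpose] at hdet
    linarith
end
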